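/- arXiv:1306.1775 — 3 statements merged into one kernel-verified Lean document; each statement's English description precedes it below -/
import Mathlib

section
/- For the boundary driven Kawasaki process on 𝒢_N with N ≥ 5 and parameters satisfying μ_L > κ > 0 > μ_R and |μ_R| > κ: if x ∈ 𝒫 and U(x,y) = 0, then y ∈ ℰ; moreover, for such y, U(y,z) = 0 implies z = x. -/
open scoped Classical

namespace Kawasaki

/-- Configurations of the lattice gas on `{1,…,N}`: each site is occupied (`true`) or empty. -/
abbrev Config (N : ℕ) := Fin N → Bool

/-- Occupation number of site `i` as a real number. -/
noncomputable def occ {N : ℕ} (x : Config N) (i : Fin N) : ℝ := if x i then 1 else 0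

/-- The nearest-neighbour interaction energy `E(x) = -κ ∑ x(i) x(i+1)`. -/
noncomputable def energy {N : ℕ} (κ : ℝ) (x : Config N) : ℝ :=
  -κ * ∑ i : Fin N, ∑ j : Fin N, if (j : ℕ) = (i : ℕ) + 1 then occ x i * occ x j else 0

/-- `x^{i,j}`: the configuration with the occupations of `i` and `j` interchanged. -/
def swapConf {N : ℕ} (x : Config N) (i j : Fin N) : Config N :=
  Function.update (Function.update x i (x j)) j (x i)

/-- `x^i`: the configuration with the occupation at `i` flipped. -/
def flipConf {N : ℕ} (x : Config N) (i : Fin N) : Config N :=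
  Function.update x i (!x i)

/-- The last site. -/
def lastIdx (N : ℕ) [NeZero N] : Fin N :=
  ⟨N - 1, Nat.sub_lt (Nat.pos_of_ne_zero (NeZero.ne N)) Nat.one_pos⟩

/-- `y` is obtained from `x` by exchanging the occupations of two nearest neighbours. -/
def IsSwap {N : ℕ} (x y : Config N) : Prop :=
  ∃ i j : Fin N, (j : ℕ) = (i : ℕ) + 1 ∧ y = swapConf x i j

/-- The allowed transitions: nearest-neighbour exchanges in the bulk,
birth/death at the two boundary sites. -/
def Allowed {N : ℕ} [NeZero N] (x y : Config N) : Prop :=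
  y ≠ x ∧ (IsSwap x y ∨ y = flipConf x 0 ∨ y = flipConf x (lastIdx N))

/-- The transition rates of the boundary driven Kawasaki process at inverse temperature `β`. -/
noncomputable def rate {N : ℕ} [NeZero N] (κ μL μR β : ℝ) (x y : Config N) : ℝ :=
  if y = x then 0
  else if IsSwap x y then Real.exp (-(β / 2) * (energy κ y - energy κ x))
  else if y = flipConf x 0 then
    Real.exp (β * μL / 2 * (1 - 2 * occ x 0)) *
      Real.exp (-(β / 2) * (energy κ y - energy κ x))
  else if y = flipConf x (lastIdx N) then
    Real.exp (β * μR / 2 * (1 - 2 * occ x (lastIdx N))) *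
      Real.exp (-(β / 2) * (energy κ y - energy κ x))
  else 0

/-- `ρ` is a stationary probability distribution for the rates at inverse temperature `β`. -/
noncomputable def IsStationary {N : ℕ} [NeZero N] (κ μL μR β : ℝ) (ρ : Config N → ℝ) : Prop :=
  (∀ x, 0 ≤ ρ x) ∧ (∑ x, ρ x = 1) ∧
  ∀ x, ∑ y, ρ y * rate κ μL μR β y x = ρ x * ∑ y, rate κ μL μR β x y

/-- `φ(x,y) = lim_{β→∞} (1/β) log k(x→y;β)` (computed explicitly, the rates being
pure exponentials in `β`). -/
noncomputable def phi {N : ℕ} [NeZero N] (κ μL μR : ℝ) (x y : Config N) : ℝ :=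
  if IsSwap x y then -(energy κ y - energy κ x) / 2
  else if y = flipConf x 0 then
    μL * (1 - 2 * occ x 0) / 2 - (energy κ y - energy κ x) / 2
  else if y = flipConf x (lastIdx N) then
    μR * (1 - 2 * occ x (lastIdx N)) / 2 - (energy κ y - energy κ x) / 2
  else 0

/-- `Γ(x) = -max_y φ(x,y)` (maximum over the allowed transitions from `x`). -/
noncomputable def Gam {N : ℕ} [NeZero N] (κ μL μR : ℝ) (x : Config N) : ℝ :=
  - sSup (phi κ μL μR x '' {y | Allowed x y})

/-- `U(x,y) = -φ(x,y) - Γ(x)` (meaningful on allowed transitions). -/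
noncomputable def Ucost {N : ℕ} [NeZero N] (κ μL μR : ℝ) (x y : Config N) : ℝ :=
  - phi κ μL μR x y - Gam κ μL μR x

/-- The cost `U(D)` of a path: sum of `U` over consecutive steps. -/
noncomputable def pathCost {N : ℕ} [NeZero N] (κ μL μR : ℝ) : List (Config N) → ℝ
  | [] => 0
  | [_] => 0
  | a :: b :: l => Ucost κ μL μR a b + pathCost κ μL μR (b :: l)

/-- `𝒰(x,y)`: the minimal cost over all paths of allowed transitions from `x` to `y`. -/
noncomputable def Ucal {N : ℕ} [NeZero N] (κ μL μR : ℝ) (x y : Config N) : ℝ :=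
  sInf { c | ∃ L : List (Config N), L.Chain' Allowed ∧ L.head? = some x ∧
    L.getLast? = some y ∧ c = pathCost κ μL μR L }

/-- `t` encodes a spanning tree of the transition graph with all edges oriented toward `x`:
`t y` is the successor of `y` on the unique path from `y` to the root `x`. -/
def IsInTree {N : ℕ} [NeZero N] (t : Config N → Config N) (x : Config N) : Prop :=
  t x = x ∧ (∀ y, y ≠ x → Allowed y (t y)) ∧ ∀ y, ∃ n : ℕ, t^[n] y = x

/-- `U(𝒯_x)`: the sum of `U` over all (oriented) edges of the in-tree. -/
noncomputable def treeCost {N : ℕ} [NeZero N] (κ μL μR : ℝ) (t : Config N → Config N)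
    (x : Config N) : ℝ :=
  ∑ y : Config N, if y = x then 0 else Ucost κ μL μR y (t y)

/-- `Θ(x) = min_𝒯 U(𝒯_x)`. -/
noncomputable def Theta {N : ℕ} [NeZero N] (κ μL μR : ℝ) (x : Config N) : ℝ :=
  sInf { c | ∃ t, IsInTree t x ∧ c = treeCost κ μL μR t x }

/-- `Ψ = Γ - Θ`. -/
noncomputable def Psi {N : ℕ} [NeZero N] (κ μL μR : ℝ) (x : Config N) : ℝ :=
  Gam κ μL μR x - Theta κ μL μR x

/-- `η_{p,q}`: `p` occupied sites followed by `q = N - p` empty sites. -/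
def eta (N p : ℕ) : Config N := fun i => decide ((i : ℕ) < p)

/-- `x ∈ 𝒟` iff `x = η_{p,q}` with `p ≥ 3`, `q ≥ 2`, `p + q = N`. -/
def memD {N : ℕ} (x : Config N) : Prop :=
  ∃ p q : ℕ, 3 ≤ p ∧ 2 ≤ q ∧ p + q = N ∧ x = eta N p

/-- The configuration written in block form `(p_0,q_0,…,p_n,q_n)`:
`p_0` occupied sites, then `q_0` empty sites, and so on. -/
def blockConfig (ps qs : List ℕ) : List Bool :=
  (ps.zip qs).flatMap fun pq => List.replicate pq.1 true ++ List.replicate pq.2 false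

/-- `x ∈ 𝒫`: block form `(p_0,q_0,…,p_n,q_n)` with all `p_i ≥ 3`,
`q_i ≥ 3` for `i < n` and `q_n ≥ 2`. -/
def memP {N : ℕ} (x : Config N) : Prop :=
  ∃ ps qs : List ℕ, ps.length = qs.length ∧ 0 < ps.length ∧
    (∀ p ∈ ps, 3 ≤ p) ∧ (∀ q ∈ qs.dropLast, 3 ≤ q) ∧ (∀ q ∈ qs.getLast?, 2 ≤ q) ∧
    List.ofFn x = blockConfig ps qs

/-- `y` is obtained from `x` by one occupation switch of the form
`…11100… → …11010…` or `…00111… → …01011…`. -/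
def isSwitchE {N : ℕ} (x y : Config N) : Prop :=
  (∃ a : ℕ, ∃ h : a + 4 < N,
    x ⟨a, by omega⟩ = true ∧ x ⟨a + 1, by omega⟩ = true ∧ x ⟨a + 2, by omega⟩ = true ∧
    x ⟨a + 3, by omega⟩ = false ∧ x ⟨a + 4, by omega⟩ = false ∧
    y = swapConf x ⟨a + 2, by omega⟩ ⟨a + 3, by omega⟩) ∨
  (∃ a : ℕ, ∃ h : a + 4 < N,
    x ⟨a, by omega⟩ = false ∧ x ⟨a + 1, by omega⟩ = false ∧ x ⟨a + 2, by omega⟩ = true ∧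
    x ⟨a + 3, by omega⟩ = true ∧ x ⟨a + 4, by omega⟩ = true ∧
    y = swapConf x ⟨a + 1, by omega⟩ ⟨a + 2, by omega⟩)

/-- `y ∈ ℰ`: obtained from some `x ∈ 𝒫` by one such switch. -/
def memE {N : ℕ} (y : Config N) : Prop := ∃ x : Config N, memP x ∧ isSwitchE x y

/-- `y` is a preferred successor of `x`: an allowed transition with `U(x,y) = 0`. -/
def PreferredStep {N : ℕ} [NeZero N] (κ μL μR : ℝ) (x y : Config N) : Prop :=
  Allowed x y ∧ Ucost κ μL μR x y = 0

/-- `𝒜_x`: the set consisting of `x` together with all its preferred successors. -/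
def Attr {N : ℕ} [NeZero N] (κ μL μR : ℝ) (x : Config N) : Set (Config N) :=
  insert x {y | PreferredStep κ μL μR x y}

/-- A nonempty set `A` is an attractor when `𝒰 = 0` inside `A` and `𝒰 > 0` from `A`
to its complement. -/
def IsAttractor {N : ℕ} [NeZero N] (κ μL μR : ℝ) (A : Set (Config N)) : Prop :=
  A.Nonempty ∧ (∀ x ∈ A, ∀ y ∈ A, x ≠ y → Ucal κ μL μR x y = 0) ∧
  ∀ x ∈ A, ∀ y, y ∉ A → 0 < Ucal κ μL μR x y

end Kawasaki

namespace Kawasaki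

/-- The occupation at site `n`, extended by `false` beyond the last site. -/
def site {N : ℕ} (x : Config N) (n : ℕ) : Bool := if h : n < N then x ⟨n, h⟩ else false

/-- The real-valued version of `site`. -/
def rsite {N : ℕ} (x : Config N) (n : ℕ) : ℝ := if site x n then 1 else 0

lemma site_of_lt {N : ℕ} (x : Config N) {n : ℕ} (h : n < N) : site x n = x ⟨n, h⟩ := by
  simp [site, h]

lemma site_of_le {N : ℕ} (x : Config N) {n : ℕ} (h : N ≤ n) : site x n = false := by
  simp [site, h]

lemma rsite_of_le {N : ℕ} (x : Config N) {n : ℕ} (h : N ≤ n) : rsite x n = 0 := by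
  simp [rsite, site_of_le x h]

lemma occ_eq_rsite {N : ℕ} (x : Config N) (i : Fin N) : occ x i = rsite x i := by
  simp [occ, rsite, site]

lemma rsite_congr {N : ℕ} {x y : Config N} {m n : ℕ} (h : site x m = site y n) :
    rsite x m = rsite y n := by
  simp [rsite, h]

lemma energy_eq {N : ℕ} (κ : ℝ) (x : Config N) :
    energy κ x = -κ * ∑ n ∈ Finset.range N, rsite x n * rsite x (n + 1) := by
  rw [energy, ← Fin.sum_univ_eq_sum_range (fun n => rsite x n * rsite x (n + 1))]
  congr 1
  refine Finset.sum_congr rfl fun i _ => ?_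
  simp only [occ_eq_rsite]
  by_cases h : (i : ℕ) + 1 < N
  · rw [Finset.sum_eq_single (⟨i + 1, h⟩ : Fin N)]
    · simp
    · intro j _ hj
      exact if_neg fun h' => hj (Fin.ext h')
    · simp
  · rw [rsite_of_le x (not_lt.mp h), mul_zero]
    exact Finset.sum_eq_zero fun j _ => if_neg fun h' => by have := j.isLt; omega

lemma site_swapConf {N : ℕ} (x : Config N) (i j : Fin N) (n : ℕ) :
    site (swapConf x i j) n =
      if n = j then site x i else if n = i then site x j else site x n := by
  by_cases h : n < N
  · simp [site, swapConf, h, Function.update_apply, Fin.ext_iff]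
  · have h₁ : n ≠ j := by have := j.isLt; omega
    have h₂ : n ≠ i := by have := i.isLt; omega
    simp [site, h, h₁, h₂]

lemma site_flipConf {N : ℕ} (x : Config N) (i : Fin N) (n : ℕ) :
    site (flipConf x i) n = if n = i then !(site x i) else site x n := by
  by_cases h : n < N
  · simp [site, flipConf, h, Function.update_apply, Fin.ext_iff]
  · have h₂ : n ≠ i := by have := i.isLt; omega
    simp [site, h, h₂]

lemma ext_site {N : ℕ} {x y : Config N} (h : ∀ n, site x n = site y n) : x = y := by
  funext i
  simpa [site] using h i

lemma site_ne_of_swapConf_ne {N : ℕ} {x : Config N} {i j : Fin N} (h : swapConf x i j ≠ x) :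
    site x i ≠ site x j := by
  intro he
  refine h (ext_site fun n => ?_)
  rw [site_swapConf]
  split_ifs with h₁ h₂
  · rw [he, h₁]
  · rw [← he, h₂]
  · rfl

lemma swapConf_ne_of_site_ne {N : ℕ} {x : Config N} {i j : Fin N} (h : site x i ≠ site x j) :
    swapConf x i j ≠ x := by
  intro he
  have := site_swapConf x i j j
  rw [he, if_pos rfl] at this
  exact h this.symm

lemma swapConf_swapConf {N : ℕ} (x : Config N) (i j : Fin N) :
    swapConf (swapConf x i j) i j = x := by
  refine ext_site fun n => ?_
  simp only [site_swapConf]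
  split_ifs <;> simp_all

/-- The energy change under an exchange of the sites `k + 1` and `k + 2`. -/
lemma energy_swapConf_sub {N : ℕ} (κ : ℝ) (x : Config N) (i j : Fin N) (k : ℕ)
    (hi : (i : ℕ) = k + 1) (hj : (j : ℕ) = k + 2) :
    energy κ (swapConf x i j) - energy κ x =
      κ * ((rsite x (k + 1) - rsite x (k + 2)) * (rsite x k - rsite x (k + 3))) := by
  obtain ⟨m, hm⟩ : ∃ m, N = k + 3 + m := ⟨N - (k + 3), by have := j.isLt; omega⟩
  have hoff : ∀ n, n ≠ k + 1 → n ≠ k + 2 → rsite (swapConf x i j) n = rsite x n := by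
    intro n h₁ h₂
    exact rsite_congr (by rw [site_swapConf, hi, hj, if_neg h₂, if_neg h₁])
  have h₁ : rsite (swapConf x i j) (k + 1) = rsite x (k + 2) :=
    rsite_congr (by rw [site_swapConf, hi, hj, if_neg (by omega), if_pos rfl])
  have h₂ : rsite (swapConf x i j) (k + 2) = rsite x (k + 1) :=
    rsite_congr (by rw [site_swapConf, hi, hj, if_pos rfl])
  have split : ∀ F : ℕ → ℝ, ∑ n ∈ Finset.range N, F n =
      ∑ n ∈ Finset.range k, F n + F k + F (k + 1) + F (k + 2) +
        ∑ n ∈ Finset.range m, F (k + 3 + n) := by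
    intro F
    rw [hm, Finset.sum_range_add, Finset.sum_range_succ, Finset.sum_range_succ,
      Finset.sum_range_succ]
  rw [energy_eq, energy_eq, split, split]
  have hl : ∑ n ∈ Finset.range k, rsite (swapConf x i j) n * rsite (swapConf x i j) (n + 1) =
      ∑ n ∈ Finset.range k, rsite x n * rsite x (n + 1) := by
    refine Finset.sum_congr rfl fun n hn => ?_
    have := Finset.mem_range.mp hn
    rw [hoff n (by omega) (by omega), hoff (n + 1) (by omega) (by omega)]
  have hr : ∑ n ∈ Finset.range m, rsite (swapConf x i j) (k + 3 + n) *
        rsite (swapConf x i j) (k + 3 + n + 1) =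
      ∑ n ∈ Finset.range m, rsite x (k + 3 + n) * rsite x (k + 3 + n + 1) := by
    refine Finset.sum_congr rfl fun n _ => ?_
    rw [hoff _ (by omega) (by omega), hoff _ (by omega) (by omega)]
  rw [hl, hr, hoff k (by omega) (by omega), hoff (k + 2 + 1) (by omega) (by omega), h₁,
    show k + 1 + 1 = k + 2 from rfl, h₂]
  ring

/-- The energy change under a flip of the first site. -/
lemma energy_flipConf_zero_sub {N : ℕ} [NeZero N] (κ : ℝ) (x : Config N) :
    energy κ (flipConf x 0) - energy κ x = -κ * ((1 - 2 * rsite x 0) * rsite x 1) := by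
  obtain ⟨m, hm⟩ : ∃ m, N = m + 1 := Nat.exists_eq_succ_of_ne_zero (NeZero.ne N)
  have hoff : ∀ n, n ≠ 0 → rsite (flipConf x 0) n = rsite x n := by
    intro n hn
    exact rsite_congr (by rw [site_flipConf, if_neg (by simpa using hn)])
  have h₀ : rsite (flipConf x 0) 0 = 1 - rsite x 0 := by
    have := site_flipConf x 0 0
    simp only [Fin.val_zero, if_true] at this
    cases h : site x 0 <;> simp [rsite, this, h]
  have split : ∀ F : ℕ → ℝ, ∑ n ∈ Finset.range N, F n =
      ∑ n ∈ Finset.range m, F (n + 1) + F 0 := by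
    intro F
    rw [hm, Finset.sum_range_succ']
  rw [energy_eq, energy_eq, split, split]
  have hl : ∑ n ∈ Finset.range m, rsite (flipConf x 0) (n + 1) * rsite (flipConf x 0) (n + 1 + 1) =
      ∑ n ∈ Finset.range m, rsite x (n + 1) * rsite x (n + 1 + 1) := by
    refine Finset.sum_congr rfl fun n _ => ?_
    rw [hoff _ (by omega), hoff _ (by omega)]
  rw [hl, hoff (0 + 1) (by omega), h₀]
  ring

/-- The energy change under a flip of the last site. -/
lemma energy_flipConf_last_sub {N : ℕ} [NeZero N] (κ : ℝ) (x : Config N) (m : ℕ)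
    (hm : N = m + 2) :
    energy κ (flipConf x (lastIdx N)) - energy κ x =
      -κ * ((1 - 2 * rsite x (m + 1)) * rsite x m) := by
  have hlast : ((lastIdx N : Fin N) : ℕ) = m + 1 := by simp [lastIdx, hm]
  have hoff : ∀ n, n ≠ m + 1 → rsite (flipConf x (lastIdx N)) n = rsite x n := by
    intro n hn
    exact rsite_congr (by rw [site_flipConf, hlast, if_neg hn])
  have h₀ : rsite (flipConf x (lastIdx N)) (m + 1) = 1 - rsite x (m + 1) := by
    have := site_flipConf x (lastIdx N) (m + 1)
    rw [hlast, if_pos rfl] at this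
    cases h : site x (m + 1) <;> simp [rsite, this, h]
  have split : ∀ F : ℕ → ℝ, ∑ n ∈ Finset.range N, F n =
      ∑ n ∈ Finset.range m, F n + F m + F (m + 1) := by
    intro F
    rw [hm, Finset.sum_range_succ, Finset.sum_range_succ]
  rw [energy_eq, energy_eq, split, split]
  have hl : ∑ n ∈ Finset.range m, rsite (flipConf x (lastIdx N)) n *
        rsite (flipConf x (lastIdx N)) (n + 1) =
      ∑ n ∈ Finset.range m, rsite x n * rsite x (n + 1) := by
    refine Finset.sum_congr rfl fun n hn => ?_
    have := Finset.mem_range.mp hn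
    rw [hoff _ (by omega), hoff _ (by omega)]
  rw [hl, hoff m (by omega), hoff (m + 1 + 1) (by omega), h₀,
    rsite_of_le x (by omega : N ≤ m + 1 + 1)]
  ring

/-- A transition of zero cost maximizes `phi`. -/
lemma phi_le_of_Ucost_eq_zero {N : ℕ} [NeZero N] {κ μL μR : ℝ} {x y w : Config N}
    (hU : Ucost κ μL μR x y = 0) (hw : Allowed x w) :
    phi κ μL μR x w ≤ phi κ μL μR x y := by
  have hle : phi κ μL μR x w ≤ sSup (phi κ μL μR x '' {y | Allowed x y}) :=
    le_csSup (Set.toFinite _).bddAbove ⟨w, hw, rfl⟩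
  unfold Ucost Gam at hU
  linarith

/-- All blocks of `true` have length at least three, and so have the blocks of `false`
(the last of which is infinite); the first block is one of `true`. -/
structure LongBlocks (f : ℕ → Bool) : Prop where
  start : f 0 = true ∧ f 1 = true ∧ f 2 = true
  fall : ∀ i, f i = true → f (i + 1) = false →
    2 ≤ i ∧ f (i - 1) = true ∧ f (i - 2) = true ∧ f (i + 2) = false ∧ f (i + 3) = false
  rise : ∀ i, f i = false → f (i + 1) = true →
    2 ≤ i ∧ f (i - 1) = false ∧ f (i - 2) = false ∧ f (i + 2) = true ∧ f (i + 3) = true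

lemma getD_block_append (p q : ℕ) (l : List Bool) (n : ℕ) :
    (List.replicate p true ++ List.replicate q false ++ l).getD n false =
      if n < p then true else if n < p + q then false else l.getD (n - (p + q)) false := by
  rw [List.append_assoc]
  split_ifs with h₁ h₂
  · rw [List.getD_append _ _ _ _ (by simpa using h₁), List.getD_replicate _ h₁]
  · rw [List.getD_append_right _ _ _ _ (by simpa using h₁), List.length_replicate,
      List.getD_append _ _ _ _ (by rw [List.length_replicate]; omega),
      List.getD_replicate _ (by omega)]
  · rw [List.getD_append_right _ _ _ _ (by rw [List.length_replicate]; omega),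
      List.getD_append_right _ _ _ _ (by simp only [List.length_replicate]; omega)]
    simp only [List.length_replicate, Nat.sub_sub]

/-- Placing an occupied block and an empty block in front of a configuration with long blocks. -/
lemma LongBlocks.cons {f g : ℕ → Bool} {p q : ℕ} (hp : 3 ≤ p) (hq : 3 ≤ q)
    (hg : LongBlocks g)
    (hf : ∀ n, f n = if n < p then true else if n < p + q then false else g (n - (p + q))) :
    LongBlocks f := by
  obtain ⟨g0, g1, g2⟩ := hg.start
  have htrue : ∀ n, n < p → f n = true := fun n h => by rw [hf, if_pos h]
  have hfalse : ∀ n, p ≤ n → n < p + q → f n = false := fun n h h' => by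
    rw [hf, if_neg (by omega), if_pos h']
  have htail : ∀ n, f (p + q + n) = g n := fun n => by
    rw [hf, if_neg (by omega), if_neg (by omega), Nat.add_sub_cancel_left]
  refine ⟨⟨htrue _ (by omega), htrue _ (by omega), htrue _ (by omega)⟩, fun i h h' => ?_,
    fun i h h' => ?_⟩
  · rcases lt_or_ge i p with hi | hi
    · have hi' : i + 1 = p := by
        by_contra hne
        rw [htrue _ (by omega)] at h'
        cases h'
      exact ⟨by omega, htrue _ (by omega), htrue _ (by omega), hfalse _ (by omega) (by omega),
        hfalse _ (by omega) (by omega)⟩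
    · have hi' : p + q ≤ i := by
        by_contra hne
        rw [hfalse _ hi (by omega)] at h
        cases h
      obtain ⟨k, rfl⟩ := Nat.exists_eq_add_of_le hi'
      obtain ⟨hk, a, b, c, d⟩ := hg.fall k (by rwa [← htail]) (by rwa [← htail])
      rw [← htail] at a b c d
      exact ⟨by omega, by rwa [Nat.add_sub_assoc (by omega)], by rwa [Nat.add_sub_assoc hk], c, d⟩
  · rcases lt_or_ge i (p + q) with hi | hi
    · have hi' : i + 1 = p + q := by
        by_contra hne
        rcases lt_or_ge i p with hi'' | hi''
        · rw [htrue _ hi''] at h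
          cases h
        · rw [hfalse _ (by omega) (by omega)] at h'
          cases h'
      refine ⟨by omega, hfalse _ (by omega) (by omega), hfalse _ (by omega) (by omega), ?_, ?_⟩
      · rw [show i + 2 = p + q + 1 by omega, htail, g1]
      · rw [show i + 3 = p + q + 2 by omega, htail, g2]
    · obtain ⟨k, rfl⟩ := Nat.exists_eq_add_of_le hi
      obtain ⟨hk, a, b, c, d⟩ := hg.rise k (by rwa [← htail]) (by rwa [← htail])
      rw [← htail] at a b c d
      exact ⟨by omega, by rwa [Nat.add_sub_assoc (by omega)], by rwa [Nat.add_sub_assoc hk], c, d⟩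

lemma longBlocks_step {p : ℕ} (hp : 3 ≤ p) : LongBlocks fun n => decide (n < p) := by
  constructor
  · simp only [decide_eq_true_eq]
    omega
  · intro i
    simp only [decide_eq_true_eq, decide_eq_false_iff_not]
    omega
  · intro i
    simp only [decide_eq_true_eq, decide_eq_false_iff_not]
    omega

lemma blockConfig_longBlocks : ∀ ps qs : List ℕ, ps.length = qs.length → 0 < ps.length →
    (∀ p ∈ ps, 3 ≤ p) → (∀ q ∈ qs.dropLast, 3 ≤ q) → (∀ q ∈ qs.getLast?, 2 ≤ q) →
    LongBlocks (fun n => (blockConfig ps qs).getD n false) ∧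
      ∃ l, blockConfig ps qs = l ++ [false, false] := by
  intro ps
  induction ps with
  | nil => intro qs _ h; simp at h
  | cons p ps ih =>
    intro qs hlen _ hp hq hlast
    cases qs with
    | nil => simp at hlen
    | cons q qs =>
      have hcons : blockConfig (p :: ps) (q :: qs) =
          List.replicate p true ++ List.replicate q false ++ blockConfig ps qs := by
        simp [blockConfig]
      rw [hcons]
      cases ps with
      | nil =>
        obtain rfl : qs = [] := by
          rw [← List.length_eq_zero_iff]
          simpa using hlen.symm
        have hq2 : 2 ≤ q := hlast q (by simp)
        constructor
        · convert longBlocks_step (hp p (by simp)) using 2 with n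
          rw [getD_block_append]
          by_cases h : n < p <;> simp [h, blockConfig]
        · obtain ⟨m, rfl⟩ := Nat.exists_eq_add_of_le' hq2
          exact ⟨List.replicate p true ++ List.replicate m false, by
            rw [List.replicate_add m 2 false]
            simp [blockConfig, List.replicate_succ]⟩
      | cons p' ps =>
        cases qs with
        | nil => simp at hlen
        | cons q' qs =>
          obtain ⟨hL, l, hl⟩ := ih (q' :: qs) (by simpa using hlen) (by simp)
            (fun r hr => hp r (List.mem_cons_of_mem _ hr))
            (fun r hr => hq r (by simp [hr])) (fun r hr => hlast r (by simpa using hr))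
          refine ⟨hL.cons (hp p (by simp)) (hq q (by simp)) fun n => getD_block_append _ _ _ _, ?_⟩
          exact ⟨List.replicate p true ++ List.replicate q false ++ l, by
            rw [hl, List.append_assoc _ l]⟩

lemma memP.longBlocks {N : ℕ} {x : Config N} (hx : memP x) :
    LongBlocks (site x) ∧ site x (N - 1) = false ∧ site x (N - 2) = false := by
  obtain ⟨ps, qs, hlen, hpos, hp, hq, hlast, hl⟩ := hx
  obtain ⟨hL, l, hl'⟩ := blockConfig_longBlocks ps qs hlen hpos hp hq hlast
  have hsite : ∀ n, (blockConfig ps qs).getD n false = site x n := by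
    intro n
    rw [← hl]
    by_cases h : n < N <;> simp [site, h, List.getD]
  have hN : N = l.length + 2 := by
    have := congrArg List.length (hl.trans hl')
    simpa using this
  refine ⟨by simpa only [hsite] using hL, ?_, ?_⟩
  · rw [← hsite, hl', hN]
    simp [List.getD]
  · rw [← hsite, hl', hN]
    simp [List.getD]

lemma LongBlocks.ne_or {f : ℕ → Bool} (hf : LongBlocks f) {i : ℕ} (h : f i ≠ f (i + 1)) :
    2 ≤ i ∧ f (i - 1) = f i ∧ f (i - 2) = f i ∧ f (i + 2) = f (i + 1) ∧
      f (i + 3) = f (i + 1) := by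
  cases h₀ : f i <;> cases h₁ : f (i + 1)
  · simp_all
  · exact hf.rise i h₀ h₁
  · exact hf.fall i h₀ h₁
  · simp_all

/-- After an exchange in a configuration with long blocks, the only isolated pair is the
exchanged one. -/
lemma LongBlocks.eq_of_alternating {f g : ℕ → Bool} (hf : LongBlocks f) {i k : ℕ}
    (hi : f i ≠ f (i + 1))
    (hg : ∀ n, g n = if n = i + 1 then f i else if n = i then f (i + 1) else f n)
    (h₁ : g k ≠ g (k + 1)) (h₂ : g k = g (k + 2)) (h₃ : g (k + 1) = g (k + 3)) :
    k + 1 = i := by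
  obtain ⟨h2, ha, hb, hc, hd⟩ := hf.ne_or hi
  obtain ⟨m, rfl⟩ := Nat.exists_eq_add_of_le' h2
  have hk := hf.ne_or (i := k)
  have hk1 := hf.ne_or (i := k + 1)
  have hk2 := hf.ne_or (i := k + 2)
  have g0 := hg k
  have g1 := hg (k + 1)
  have g2 := hg (k + 2)
  have g3 := hg (k + 3)
  simp only [Nat.add_sub_cancel, show m + 2 - 1 = m + 1 by omega] at *
  grind

/-- Every exchange in a configuration with long blocks is one of the two switches. -/
lemma isSwitchE_swapConf {N : ℕ} {x : Config N} (hL : LongBlocks (site x))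
    (hl : site x (N - 1) = false) (hl' : site x (N - 2) = false) {i j : Fin N}
    (hij : (j : ℕ) = i + 1) (hne : site x i ≠ site x j) :
    isSwitchE x (swapConf x i j) := by
  obtain ⟨i, hi⟩ := i
  obtain ⟨j, hj⟩ := j
  simp only at hij hne
  subst hij
  have site_lt : ∀ n, site x n = true → n + 2 < N := by
    intro n hn
    by_contra h
    rcases (by omega : N ≤ n ∨ n = N - 1 ∨ n = N - 2) with h | h | h
    · simp [site_of_le x h] at hn
    · simp [h, hl] at hn
    · simp [h, hl'] at hn
  obtain ⟨h2, ha, hb, hc, hd⟩ := hL.ne_or hne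
  obtain ⟨a, rfl⟩ := Nat.exists_eq_add_of_le' h2
  simp only [Nat.add_sub_cancel, show a + 2 - 1 = a + 1 by omega] at ha hb
  cases h₀ : site x (a + 2) <;> cases h₁ : site x (a + 2 + 1)
  · exact absurd (h₀.trans h₁.symm) hne
  · rw [h₀] at ha hb
    rw [h₁] at hc hd
    have := site_lt _ hd
    refine Or.inr ⟨a + 1, by omega, ?_, ?_, ?_, ?_, ?_, rfl⟩ <;>
      (rw [← site_of_lt x]; assumption)
  · rw [h₀] at ha hb
    rw [h₁] at hc hd
    have := site_lt _ h₀
    refine Or.inl ⟨a, by omega, ?_, ?_, ?_, ?_, ?_, rfl⟩ <;>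
      (rw [← site_of_lt x]; assumption)
  · exact absurd (h₀.trans h₁.symm) hne

section Dynamics

variable {N : ℕ} [NeZero N] {κ μL μR : ℝ}

lemma phi_swapConf (x : Config N) (i j : Fin N) (k : ℕ)
    (hi : (i : ℕ) = k + 1) (hj : (j : ℕ) = k + 2) :
    phi κ μL μR x (swapConf x i j) =
      -(κ * ((rsite x (k + 1) - rsite x (k + 2)) * (rsite x k - rsite x (k + 3)))) / 2 := by
  rw [phi, if_pos ⟨i, j, by omega, rfl⟩, energy_swapConf_sub κ x i j k hi hj]

/-- Boundary flips have rate exponent below `-κ / 2`, or below `0` if the last two sites are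
not both empty. -/
lemma phi_flip_lt (hN : 2 ≤ N) (hκ : 0 < κ) (hμL : κ < μL) (hμRκ : μR < -κ) {x y : Config N}
    (h0 : site x 0 = true) (h1 : site x 1 = true) (hl : site x (N - 1) = false)
    (hy : Allowed x y) (hs : ¬ IsSwap x y) :
    phi κ μL μR x y < κ * rsite x (N - 2) / 2 - κ / 2 := by
  obtain ⟨m, hm⟩ := Nat.exists_eq_add_of_le' hN
  have hm1 : N - 1 = m + 1 := by omega
  have hm2 : N - 2 = m := by omega
  have hnonneg : 0 ≤ rsite x (N - 2) := by
    unfold rsite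
    split_ifs <;> norm_num
  have hlast : ((lastIdx N : Fin N) : ℕ) = m + 1 := by simp [lastIdx, hm]
  have r0 : rsite x 0 = 1 := by simp [rsite, h0]
  have r1 : rsite x 1 = 1 := by simp [rsite, h1]
  have rl : rsite x (m + 1) = 0 := by simp [rsite, ← hm1, hl]
  unfold phi
  rw [if_neg hs]
  have hmul : 0 ≤ κ * rsite x (N - 2) := mul_nonneg hκ.le hnonneg
  by_cases hy0 : y = flipConf x 0
  · rw [if_pos hy0, hy0, energy_flipConf_zero_sub, occ_eq_rsite, Fin.val_zero, r0, r1]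
    linarith
  · have hyl : y = flipConf x (lastIdx N) := by
      rcases hy.2 with h | h | h
      · exact absurd h hs
      · exact absurd h hy0
      · exact h
    rw [if_neg hy0, if_pos hyl, hyl, energy_flipConf_last_sub κ x m hm, occ_eq_rsite, hlast, rl,
      hm2]
    linarith

lemma phi_swapConf_of_longBlocks {x : Config N} (hL : LongBlocks (site x)) {i j : Fin N}
    (hij : (j : ℕ) = i + 1) (hne : site x i ≠ site x j) :
    phi κ μL μR x (swapConf x i j) = -κ / 2 := by
  rw [hij] at hne
  obtain ⟨h2, ha, -, hc, -⟩ := hL.ne_or hne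
  obtain ⟨k, hk⟩ := Nat.exists_eq_add_of_le' (show 1 ≤ (i : ℕ) by omega)
  rw [phi_swapConf x i j k hk (by omega)]
  rw [hk] at hne ha hc
  simp only [Nat.add_sub_cancel] at ha
  cases h₁ : site x (k + 1) <;> cases h₂ : site x (k + 2) <;> simp_all [rsite]

/-- From a configuration with long blocks there is an exchange that changes it. -/
lemma exists_swapConf_of_longBlocks {x : Config N} (hL : LongBlocks (site x))
    (hl : site x (N - 1) = false) :
    ∃ i j : Fin N, (j : ℕ) = i + 1 ∧ site x i ≠ site x j := by
  by_contra! h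
  have hall : ∀ n, n < N → site x n = true := by
    intro n
    induction n with
    | zero => exact fun _ => hL.start.1
    | succ n ih => exact fun hn => (h ⟨n, by omega⟩ ⟨n + 1, hn⟩ rfl) ▸ ih (by omega)
  have := hall (N - 1) (Nat.sub_lt (Nat.pos_of_ne_zero (NeZero.ne N)) Nat.one_pos)
  simp [hl] at this

lemma phi_swapConf_self {x : Config N} (hL : LongBlocks (site x)) {i j : Fin N}
    (hij : (j : ℕ) = i + 1) (hne : site x i ≠ site x j) :
    phi κ μL μR (swapConf x i j) x = κ / 2 := by
  have hback := phi_swapConf_of_longBlocks (κ := κ) (μL := μL) (μR := μR) hL hij hne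
  rw [phi, if_pos ⟨i, j, hij, rfl⟩] at hback
  rw [phi, if_pos ⟨i, j, hij, (swapConf_swapConf x i j).symm⟩]
  linarith

end Dynamics

end Kawasaki

open Kawasaki in
/-- for `μ_L > κ > 0 > μ_R`, `|μ_R| > κ`: if `x ∈ 𝒫` and `U(x,y) = 0`
(along an allowed transition), then `y ∈ ℰ`; moreover for such `y`, `U(y,z) = 0`
implies `z = x`. -/
theorem statement5 (N : ℕ) [NeZero N] (hN : 5 ≤ N) (κ μL μR : ℝ)
    (hκ : 0 < κ) (hμL : κ < μL) (hμR : μR < 0) (hμRκ : κ < |μR|) :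
    ∀ x y : Config N, memP x → Allowed x y → Ucost κ μL μR x y = 0 →
      memE y ∧ ∀ z : Config N, Allowed y z → Ucost κ μL μR y z = 0 → z = x := by
  intro x y hx hxy hU
  rw [abs_of_neg hμR] at hμRκ
  have hμR' : μR < -κ := by linarith
  obtain ⟨hL, hl, hl'⟩ := hx.longBlocks
  have hswap : IsSwap x y := by
    by_contra hs
    obtain ⟨i, j, hij, hne⟩ := exists_swapConf_of_longBlocks hL hl
    have hle := phi_le_of_Ucost_eq_zero hU
      ⟨swapConf_ne_of_site_ne hne, Or.inl ⟨i, j, hij, rfl⟩⟩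
    rw [phi_swapConf_of_longBlocks hL hij hne] at hle
    have hlt := phi_flip_lt (by omega) hκ hμL hμR' hL.start.1 hL.start.2.1 hl hxy hs
    have : rsite x (N - 2) = 0 := by simp [rsite, hl']
    rw [this] at hlt
    linarith
  obtain ⟨i, j, hij, rfl⟩ := hswap
  have hne := site_ne_of_swapConf_ne hxy.1
  refine ⟨⟨x, hx, isSwitchE_swapConf hL hl hl' hij hne⟩, fun z hz hUz => ?_⟩
  have hle := phi_le_of_Ucost_eq_zero hUz
    ⟨hxy.1.symm, Or.inl ⟨i, j, hij, (swapConf_swapConf x i j).symm⟩⟩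
  rw [phi_swapConf_self hL hij hne] at hle
  have hne' : site x i ≠ site x (i + 1) := hij ▸ hne
  have hi2 := (hL.ne_or hne').1
  have hsite := site_swapConf x i j
  rw [hij] at hsite
  have h0 : site (swapConf x i j) 0 = true := by
    rw [hsite, if_neg (by omega), if_neg (by omega), hL.start.1]
  have h1 : site (swapConf x i j) 1 = true := by
    rw [hsite, if_neg (by omega), if_neg (by omega), hL.start.2.1]
  have hlast : site (swapConf x i j) (N - 1) = false := by
    have hj := j.isLt
    rw [hsite, if_neg, if_neg (by omega), hl]
    intro h
    have : (i : ℕ) = N - 2 := by omega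
    rw [← h, this, hl', hl] at hne'
    exact hne' rfl
  have hswap : IsSwap (swapConf x i j) z := by
    by_contra hs
    have hlt := phi_flip_lt (by omega) hκ hμL hμR' h0 h1 hlast hz hs
    have : rsite (swapConf x i j) (N - 2) ≤ 1 := by
      unfold rsite
      split_ifs <;> norm_num
    nlinarith
  obtain ⟨i', j', hij', rfl⟩ := hswap
  have hneg := site_ne_of_swapConf_ne hz.1
  have hi' : 1 ≤ (i' : ℕ) := by
    by_contra h
    have h' : (i' : ℕ) = 0 := by omega
    rw [hij', h', h0, h1] at hneg
    exact hneg rfl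
  obtain ⟨k, hk⟩ := Nat.exists_eq_add_of_le' hi'
  have hij'' : (j' : ℕ) = k + 2 := by omega
  rw [phi_swapConf _ i' j' k hk hij''] at hle
  rw [hk, hij''] at hneg
  have hpat : site (swapConf x i j) k ≠ site (swapConf x i j) (k + 1) ∧
      site (swapConf x i j) k = site (swapConf x i j) (k + 2) ∧
      site (swapConf x i j) (k + 1) = site (swapConf x i j) (k + 3) := by
    revert hle hneg
    unfold rsite
    cases site (swapConf x i j) k <;> cases site (swapConf x i j) (k + 1) <;>
      cases site (swapConf x i j) (k + 2) <;> cases site (swapConf x i j) (k + 3) <;>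
      simp <;> linarith
  have hki := hL.eq_of_alternating hne' hsite hpat.1 hpat.2.1 hpat.2.2
  obtain rfl : i' = i := Fin.ext (by omega)
  obtain rfl : j' = j := Fin.ext (by omega)
  exact swapConf_swapConf x i' j'
end

section
/- For the boundary driven simple exclusion process (the boundary driven Kawasaki process with κ = 0) on 𝒢_N with N ≥ 2 and μ_L > 0 > μ_R: the unique stationary distribution ρ_β satisfies lim_{β→∞} (1/β) log ρ_β(x) = 0 if and only if x(1) = 1 and x(N) = 0; for every other configuration x, limsup_{β→∞} (1/β) log ρ_β(x) < 0. -/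
open scoped Classical

namespace Kawasaki

lemma energy_zero {N : ℕ} (x : Config N) : energy 0 x = 0 := by
  simp [energy]

lemma swapConf_ne_flipConf {N : ℕ} (x : Config N) {i j : Fin N} (hij : i ≠ j) (k : Fin N) :
    swapConf x i j ≠ flipConf x k := by
  intro h
  have hi := congrFun h i
  have hj := congrFun h j
  have hk := congrFun h k
  by_cases hki : k = i
  · subst hki
    simp [swapConf, flipConf, hij, hij.symm] at hi hj
    simp [hj] at hi
  · by_cases hkj : k = j
    · subst hkj
      simp [swapConf, flipConf, hij] at hi hj
      simp [hi] at hj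
    · simp [swapConf, flipConf, hki, hkj] at hk

lemma not_isSwap_flipConf {N : ℕ} (x : Config N) (k : Fin N) : ¬ IsSwap x (flipConf x k) := by
  rintro ⟨i, j, hij, h⟩
  exact swapConf_ne_flipConf x (by rintro rfl; omega) k h.symm

lemma flipConf_ne {N : ℕ} (x : Config N) (k : Fin N) : flipConf x k ≠ x := by
  intro h
  have := congrFun h k
  simp [flipConf] at this

lemma zero_ne_lastIdx {N : ℕ} [NeZero N] (hN : 2 ≤ N) : (0 : Fin N) ≠ lastIdx N := by
  intro h
  have := congrArg Fin.val h
  simp [lastIdx] at this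
  omega

lemma flipConf_last_ne_flipConf_zero {N : ℕ} [NeZero N] (hN : 2 ≤ N) (x : Config N) :
    flipConf x (lastIdx N) ≠ flipConf x 0 := by
  intro h
  have := congrFun h 0
  simp [flipConf, zero_ne_lastIdx hN] at this

section Rates

variable {N : ℕ} [NeZero N] {μL μR β : ℝ}

lemma rate_swapConf {x : Config N} {i j : Fin N} (hij : (j : ℕ) = i + 1)
    (hne : swapConf x i j ≠ x) : rate 0 μL μR β x (swapConf x i j) = 1 := by
  rw [rate, if_neg hne, if_pos ⟨i, j, hij, rfl⟩]
  simp [energy_zero]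

lemma rate_flipConf_zero (x : Config N) :
    rate 0 μL μR β x (flipConf x 0) = Real.exp (β * μL / 2 * (1 - 2 * occ x 0)) := by
  rw [rate, if_neg (flipConf_ne x 0), if_neg (not_isSwap_flipConf x 0), if_pos rfl]
  simp [energy_zero]

lemma rate_flipConf_last (hN : 2 ≤ N) (x : Config N) :
    rate 0 μL μR β x (flipConf x (lastIdx N)) =
      Real.exp (β * μR / 2 * (1 - 2 * occ x (lastIdx N))) := by
  rw [rate, if_neg (flipConf_ne x _), if_neg (not_isSwap_flipConf x _),
    if_neg (flipConf_last_ne_flipConf_zero hN x), if_pos rfl]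
  simp [energy_zero]

lemma rate_nonneg (x y : Config N) : 0 ≤ rate 0 μL μR β x y := by
  unfold rate
  split_ifs <;> positivity

lemma rate_le {x : Config N} {B : ℝ} (h1 : 1 ≤ B)
    (hL : Real.exp (β * μL / 2 * (1 - 2 * occ x 0)) ≤ B)
    (hR : Real.exp (β * μR / 2 * (1 - 2 * occ x (lastIdx N))) ≤ B) (y : Config N) :
    rate 0 μL μR β x y ≤ B := by
  unfold rate
  simp only [energy_zero, sub_zero, mul_zero, Real.exp_zero, mul_one]
  split_ifs <;> linarith

/-- One incoming transition bounds the stationary weight of its target from below. -/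
lemma IsStationary.mul_rate_le {ρ : Config N → ℝ} (h : IsStationary 0 μL μR β ρ)
    (z : Config N) {y : Config N} {B : ℝ} (hB : ∀ x, rate 0 μL μR β y x ≤ B) :
    ρ z * rate 0 μL μR β z y ≤ ρ y * (Fintype.card (Config N) * B) := by
  obtain ⟨h0, -, hst⟩ := h
  calc ρ z * rate 0 μL μR β z y ≤ ∑ x, ρ x * rate 0 μL μR β x y :=
        Finset.single_le_sum (f := fun x => ρ x * rate 0 μL μR β x y)
          (fun x _ => mul_nonneg (h0 x) (rate_nonneg x y)) (Finset.mem_univ z)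
    _ = ρ y * ∑ x, rate 0 μL μR β y x := hst y
    _ ≤ ρ y * (Fintype.card (Config N) * B) := by
        refine mul_le_mul_of_nonneg_left ?_ (h0 y)
        simpa using Finset.sum_le_card_nsmul Finset.univ _ B fun x _ => hB x

lemma IsStationary.le_one {ρ : Config N → ℝ} (h : IsStationary 0 μL μR β ρ) (x : Config N) :
    ρ x ≤ 1 :=
  h.2.1 ▸ Finset.single_le_sum (fun y _ => h.1 y) (Finset.mem_univ x)

end Rates

/-- `y` carries at least the stationary weight of `z`, up to a constant and a power of `w`. -/
def Dominates {N : ℕ} (w : ℝ → ℝ) (ρ : ℝ → Config N → ℝ) (z y : Config N) : Prop :=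
  ∃ c > 0, ∃ n : ℕ, ∀ β > 0, c * w β ^ n * ρ β z ≤ ρ β y

lemma Dominates.refl {N : ℕ} (w : ℝ → ℝ) (ρ : ℝ → Config N → ℝ) (z : Config N) :
    Dominates w ρ z z :=
  ⟨1, one_pos, 0, by simp⟩

lemma Dominates.trans {N : ℕ} {w : ℝ → ℝ} (hw : ∀ β, 0 ≤ w β) {ρ : ℝ → Config N → ℝ}
    {x y z : Config N} (h : Dominates w ρ x y) (h' : Dominates w ρ y z) : Dominates w ρ x z := by
  obtain ⟨c, hc, n, h⟩ := h
  obtain ⟨d, hd, m, h'⟩ := h'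
  refine ⟨d * c, by positivity, m + n, fun β hβ => ?_⟩
  calc d * c * w β ^ (m + n) * ρ β x = d * w β ^ m * (c * w β ^ n * ρ β x) := by ring
    _ ≤ d * w β ^ m * ρ β y :=
        mul_le_mul_of_nonneg_left (h β hβ) (mul_nonneg hd.le (pow_nonneg (hw β) m))
    _ ≤ ρ β z := h' β hβ

section Connectivity

variable {N : ℕ} {R : Config N → Config N → Prop} {G : Config N → Prop}

/-- Moving the ability to set a site to `v` to a site it can be exchanged with. -/
lemma setSite_of_exchange (hrefl : ∀ z, R z z) (htrans : ∀ x y z, R x y → R y z → R x z)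
    {i j : Fin N} (hij : i ≠ j)
    (hswap : ∀ z, G z → R z (swapConf z i j)) (hGi : ∀ z v, G z → G (Function.update z i v))
    (hGj : ∀ z v, G z → G (Function.update z j v)) {v : Bool}
    (h : ∀ z, G z → R z (Function.update z i v)) (z : Config N) (hz : G z) :
    R z (Function.update z j v) := by
  by_cases hj : z j = v
  · rw [← hj, Function.update_eq_self]
    exact hrefl z
  by_cases hi : z i = v
  · have hG : G (swapConf z i j) := hGj _ _ (hGi _ _ hz)
    convert htrans _ _ _ (hswap z hz) (h _ hG) using 1
    ext k
    by_cases hki : k = i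
    · subst hki; simp [hij, hi]
    · by_cases hkj : k = j
      · subst hkj; simp [swapConf, hki, hi]
      · simp [swapConf, hki, hkj]
  · convert htrans _ _ _ (h z hz) (hswap _ (hGi _ _ hz)) using 1
    ext k
    have hji : z i = z j := by
      revert hi hj
      cases z i <;> cases z j <;> cases v <;> simp
    by_cases hki : k = i
    · subst hki; simp [swapConf, hij, hij.symm, hji]
    · by_cases hkj : k = j
      · subst hkj; simp [swapConf]
      · simp [swapConf, hki, hkj]

lemma swapConf_comm (z : Config N) {i j : Fin N} (hij : i ≠ j) :
    swapConf z i j = swapConf z j i :=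
  Function.update_comm hij _ _ _

/-- Configurations agreeing off a set of settable sites are related. -/
lemma rel_of_setSite (hrefl : ∀ z, R z z) (htrans : ∀ x y z, R x y → R y z → R x z)
    (I : Finset (Fin N)) (hG : ∀ i ∈ I, ∀ z v, G z → G (Function.update z i v))
    (h : ∀ i ∈ I, ∀ v z, G z → R z (Function.update z i v))
    {z y : Config N} (hz : G z) (hzy : ∀ i ∉ I, z i = y i) : R z y := by
  have key : ∀ S : Finset (Fin N), S ⊆ I → R z (S.piecewise y z) ∧ G (S.piecewise y z) := by
    intro S
    induction S using Finset.induction_on with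
    | empty => intro _; simpa using ⟨hrefl z, hz⟩
    | insert a S ha ih =>
      intro hS
      obtain ⟨h1, h2⟩ := ih ((Finset.subset_insert a S).trans hS)
      have haI := hS (Finset.mem_insert_self a S)
      rw [Finset.piecewise_insert]
      exact ⟨htrans _ _ _ h1 (h a haI _ _ h2), hG a haI _ _ h2⟩
  convert (key I subset_rfl).1 using 1
  ext i
  by_cases hi : i ∈ I <;> simp [hi, hzy]

end Connectivity

/-- The left end is occupied and the right end is empty. -/
def EndsAligned {N : ℕ} [NeZero N] (x : Config N) : Prop :=
  x 0 = true ∧ x (lastIdx N) = false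

lemma EndsAligned.update {N : ℕ} [NeZero N] {i : Fin N} (h0 : i ≠ 0) (hl : i ≠ lastIdx N)
    (z : Config N) (v : Bool) (hz : EndsAligned z) : EndsAligned (Function.update z i v) := by
  simpa [EndsAligned, h0.symm, hl.symm] using hz

lemma card_config_pos {N : ℕ} : (0 : ℝ) < Fintype.card (Config N) := by
  exact_mod_cast Fintype.card_pos

lemma one_le_card_config {N : ℕ} : (1 : ℝ) ≤ Fintype.card (Config N) := by
  exact_mod_cast Fintype.card_pos (α := Config N)

section Bounds

variable {N : ℕ} [NeZero N] {μL μR : ℝ} {ρ : ℝ → Config N → ℝ}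

lemma rate_le_one {β : ℝ} (hμL : 0 < μL) (hμR : μR < 0) (hβ : 0 < β) {x : Config N}
    (hx : EndsAligned x) (y : Config N) : rate 0 μL μR β x y ≤ 1 := by
  refine rate_le le_rfl ?_ ?_ y
  · simp only [occ, hx.1, if_true, Real.exp_le_one_iff]
    nlinarith [mul_pos hβ hμL]
  · simp only [occ, hx.2, Real.exp_le_one_iff]
    simp
    nlinarith [mul_neg_of_pos_of_neg hβ hμR]

lemma rate_le_exp_left {β : ℝ} (hμL : 0 < μL) (hμR : μR < 0) (hβ : 0 < β) {x : Config N}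
    (h0 : x 0 = false) (hl : x (lastIdx N) = false) (y : Config N) :
    rate 0 μL μR β x y ≤ Real.exp (β * μL / 2) := by
  have h1 := mul_pos hβ hμL
  have h2 := mul_neg_of_pos_of_neg hβ hμR
  refine rate_le (Real.one_le_exp (by linarith)) ?_ ?_ y
  · simp [occ, h0]
  · rw [occ, hl, if_neg (by simp), Real.exp_le_exp]
    linarith

lemma rate_le_exp_right {β : ℝ} (hμL : 0 < μL) (hμR : μR < 0) (hβ : 0 < β) {x : Config N}
    (h0 : x 0 = true) (hl : x (lastIdx N) = true) (y : Config N) :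
    rate 0 μL μR β x y ≤ Real.exp (-(β * μR / 2)) := by
  have h1 := mul_pos hβ hμL
  have h2 := mul_neg_of_pos_of_neg hβ hμR
  refine rate_le (Real.one_le_exp (by linarith)) ?_ ?_ y <;>
    simp only [occ, h0, hl, Real.exp_le_exp] <;> simp <;> nlinarith

lemma rate_le_exp {β : ℝ} (hμL : 0 < μL) (hμR : μR < 0) (hβ : 0 < β) (x y : Config N) :
    rate 0 μL μR β x y ≤ Real.exp (β * ((μL - μR) / 2)) := by
  have h1 := mul_pos hβ hμL
  have h2 := mul_neg_of_pos_of_neg hβ hμR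
  refine rate_le (Real.one_le_exp (by nlinarith)) ?_ ?_ y <;>
    (simp only [occ, Real.exp_le_exp]; split_ifs <;> nlinarith)

lemma rate_flipConf_zero_of_empty {β : ℝ} {x : Config N} (h : x 0 = false) :
    rate 0 μL μR β x (flipConf x 0) = Real.exp (β * μL / 2) := by
  rw [rate_flipConf_zero]
  simp [occ, h]

lemma rate_flipConf_last_of_occupied {β : ℝ} (hN : 2 ≤ N) {x : Config N}
    (h : x (lastIdx N) = true) :
    rate 0 μL μR β x (flipConf x (lastIdx N)) = Real.exp (-(β * μR / 2)) := by
  rw [rate_flipConf_last hN]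
  simp [occ, h]
  ring

lemma weight_le_of_left_empty {β : ℝ} (hN : 2 ≤ N) (hμL : 0 < μL) (hμR : μR < 0)
    {π : Config N → ℝ} (h : IsStationary 0 μL μR β π) (hβ : 0 < β) {x : Config N}
    (h0 : x 0 = false) (hl : x (lastIdx N) = false) :
    π x * Real.exp (β * μL / 2) ≤ π (flipConf x 0) * Fintype.card (Config N) := by
  have hG : EndsAligned (flipConf x 0) := by
    simp [EndsAligned, flipConf, (zero_ne_lastIdx hN).symm, h0, hl]
  simpa [rate_flipConf_zero_of_empty h0] using
    h.mul_rate_le x (rate_le_one hμL hμR hβ hG)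

lemma weight_le_of_right_occupied {β : ℝ} (hN : 2 ≤ N) (hμL : 0 < μL) (hμR : μR < 0)
    {π : Config N → ℝ} (h : IsStationary 0 μL μR β π) (hβ : 0 < β) {x : Config N}
    (h0 : x 0 = true) (hl : x (lastIdx N) = true) :
    π x * Real.exp (-(β * μR / 2)) ≤ π (flipConf x (lastIdx N)) * Fintype.card (Config N) := by
  have hG : EndsAligned (flipConf x (lastIdx N)) := by
    simp [EndsAligned, flipConf, zero_ne_lastIdx hN, h0, hl]
  simpa [rate_flipConf_last_of_occupied hN hl] using
    h.mul_rate_le x (rate_le_one hμL hμR hβ hG)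

/-- Configurations with a misaligned end have exponentially small stationary weight. -/
lemma weight_le_exp_of_not_endsAligned {β : ℝ} (hN : 2 ≤ N) (hμL : 0 < μL) (hμR : μR < 0)
    {π : Config N → ℝ} (h : IsStationary 0 μL μR β π) (hβ : 0 < β) {x : Config N}
    (hx : ¬ EndsAligned x) :
    π x ≤ (Fintype.card (Config N) : ℝ) ^ 2 * Real.exp (-(β * (min μL (-μR) / 2))) := by
  set K : ℝ := (Fintype.card (Config N) : ℝ) with hK
  have hK1 : 1 ≤ K := one_le_card_config
  have reduce : ∀ t, min μL (-μR) ≤ t → π x * Real.exp (β * t / 2) ≤ K ^ 2 →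
      π x ≤ K ^ 2 * Real.exp (-(β * (min μL (-μR) / 2))) := by
    intro t ht hle
    rw [Real.exp_neg, ← div_eq_mul_inv, le_div_iff₀ (Real.exp_pos _)]
    refine le_trans (mul_le_mul_of_nonneg_left (Real.exp_le_exp.2 ?_) (h.1 x)) hle
    nlinarith
  have hone : ∀ y, π y * K ≤ K := fun y =>
    mul_le_of_le_one_left (by linarith) (h.le_one y)
  cases h0 : x 0 <;> cases hl : x (lastIdx N)
  · refine reduce μL (min_le_left _ _) ?_
    have := weight_le_of_left_empty hN hμL hμR h hβ h0 hl
    nlinarith [hone (flipConf x 0)]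
  · refine reduce μL (min_le_left _ _) ?_
    have h0' : flipConf x 0 0 = true := by simp [flipConf, h0]
    have hl' : flipConf x 0 (lastIdx N) = true := by
      simp [flipConf, (zero_ne_lastIdx hN).symm, hl]
    have h1 := h.mul_rate_le x (rate_le_exp_right hμL hμR hβ h0' hl')
    rw [rate_flipConf_zero_of_empty h0] at h1
    have h2 := weight_le_of_right_occupied hN hμL hμR h hβ h0' hl'
    have h3 := hone (flipConf (flipConf x 0) (lastIdx N))
    rw [← hK] at h1 h2
    nlinarith
  · exact absurd ⟨h0, hl⟩ hx
  · refine reduce (-μR) (min_le_right _ _) ?_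
    have := weight_le_of_right_occupied hN hμL hμR h hβ h0 hl
    rw [show β * -μR / 2 = -(β * μR / 2) by ring]
    nlinarith [hone (flipConf x (lastIdx N))]

/-- Any two configurations dominate each other up to an exponential factor. -/
lemma dominates_exp (hμL : 0 < μL) (hμR : μR < 0)
    (hρ : ∀ β : ℝ, 0 < β → IsStationary 0 μL μR β (ρ β)) (z y : Config N) :
    Dominates (fun β => Real.exp (-(β * ((μL - μR) / 2)))) ρ z y := by
  set w : ℝ → ℝ := fun β => Real.exp (-(β * ((μL - μR) / 2))) with hw
  have hK : (0 : ℝ) < Fintype.card (Config N) := card_config_pos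
  have hrefl := Dominates.refl w ρ
  have htrans : ∀ x y z, Dominates w ρ x y → Dominates w ρ y z → Dominates w ρ x z :=
    fun x y z => Dominates.trans (fun β => (Real.exp_pos _).le)
  have step : ∀ (x y : Config N) (n : ℕ),
      (∀ β > 0, w β ^ n ≤ rate 0 μL μR β x y) → Dominates w ρ x y := by
    intro x y n hn
    refine ⟨(Fintype.card (Config N) : ℝ)⁻¹, by positivity, n + 1, fun β hβ => ?_⟩
    have h1 := (hρ β hβ).mul_rate_le x (rate_le_exp hμL hμR hβ y)
    have h2 := mul_le_mul_of_nonneg_left (hn β hβ) ((hρ β hβ).1 x)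
    have hwpos : 0 < w β := Real.exp_pos _
    have hexp : Real.exp (β * ((μL - μR) / 2)) = (w β)⁻¹ := by
      rw [hw]; simp [Real.exp_neg]
    rw [hexp] at h1
    have h3 := h2.trans h1
    calc (Fintype.card (Config N) : ℝ)⁻¹ * w β ^ (n + 1) * ρ β x
        = (Fintype.card (Config N) : ℝ)⁻¹ * w β * (ρ β x * w β ^ n) := by ring
      _ ≤ (Fintype.card (Config N) : ℝ)⁻¹ * w β *
          (ρ β y * (Fintype.card (Config N) * (w β)⁻¹)) :=
          mul_le_mul_of_nonneg_left h3 (by positivity)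
      _ = ρ β y := by field_simp
  have hswap : ∀ i j : Fin N, (j : ℕ) = i + 1 → ∀ z, Dominates w ρ z (swapConf z i j) := by
    intro i j hij z
    by_cases hz : swapConf z i j = z
    · rw [hz]; exact hrefl z
    · exact step _ _ 0 fun β _ => by simp [rate_swapConf hij hz]
  have hflip : ∀ z, Dominates w ρ z (flipConf z 0) := by
    intro z
    refine step _ _ 1 fun β hβ => ?_
    rw [rate_flipConf_zero, pow_one, hw, Real.exp_le_exp]
    have h1 := mul_pos hβ hμL
    have h2 := mul_neg_of_pos_of_neg hβ hμR
    unfold occ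
    split_ifs <;> nlinarith
  have hset : ∀ (v : Bool) (k : ℕ) (hk : k < N) (z : Config N),
      Dominates w ρ z (Function.update z ⟨k, hk⟩ v) := by
    intro v k
    induction k with
    | zero =>
      intro hk z
      by_cases hv : z 0 = v
      · convert hrefl z using 1
        exact Function.update_eq_self_iff.2 hv.symm
      · convert hflip z using 1
        have : v = !z 0 := by cases v <;> cases h : z 0 <;> simp_all
        rw [this]
        rfl
    | succ k ih =>
      intro hk z
      exact setSite_of_exchange (G := fun _ => True) hrefl htrans
        (i := ⟨k, by omega⟩) (j := ⟨k + 1, hk⟩) (by simp) (fun z _ => hswap _ _ rfl z)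
        (fun _ _ _ => trivial) (fun _ _ _ => trivial) (fun z _ => ih _ z) z trivial
  exact rel_of_setSite (G := fun _ => True) hrefl htrans Finset.univ
    (fun _ _ _ _ _ => trivial) (fun i _ v z _ => hset v i i.2 z) trivial (by simp)

/-- Configurations with aligned ends have comparable stationary weights, uniformly in `β`. -/
lemma dominates_one (hN : 2 ≤ N) (hμL : 0 < μL) (hμR : μR < 0)
    (hρ : ∀ β : ℝ, 0 < β → IsStationary 0 μL μR β (ρ β)) {z y : Config N}
    (hz : EndsAligned z) (hy : EndsAligned y) : Dominates (fun _ => 1) ρ z y := by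
  set w : ℝ → ℝ := fun _ => 1 with hw
  set K : ℝ := (Fintype.card (Config N) : ℝ) with hKdef
  have hK : 0 < K := card_config_pos
  have hrefl := Dominates.refl w ρ
  have htrans : ∀ x y z, Dominates w ρ x y → Dominates w ρ y z → Dominates w ρ x z :=
    fun x y z => Dominates.trans (fun β => zero_le_one)
  have hswap : ∀ i j : Fin N, (j : ℕ) = i + 1 → i ≠ 0 → j ≠ lastIdx N → ∀ z, EndsAligned z →
      Dominates w ρ z (swapConf z i j) := by
    intro i j hij hi hj z hz
    by_cases hne : swapConf z i j = z
    · rw [hne]; exact hrefl z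
    have hi' : i ≠ lastIdx N := by
      rintro rfl
      have := j.2
      simp [lastIdx] at hij
      omega
    have hj' : j ≠ 0 := by
      rintro rfl
      simp at hij
    have hG : EndsAligned (swapConf z i j) :=
      EndsAligned.update hj' hj _ _ (EndsAligned.update hi hi' _ _ hz)
    refine ⟨K⁻¹, by positivity, 0, fun β hβ => ?_⟩
    have h1 := (hρ β hβ).mul_rate_le z (rate_le_one hμL hμR hβ hG)
    rw [rate_swapConf hij hne, mul_one, mul_one, ← hKdef] at h1
    rw [pow_zero, mul_one, inv_mul_le_iff₀ hK]
    linarith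
  have twoStep : ∀ (z u y : Config N), (∀ β > 0, ∃ A,
      ρ β z ≤ ρ β u * (K * A) ∧ ρ β u * A ≤ ρ β y * K) → Dominates w ρ z y := by
    intro z u y h
    refine ⟨(K ^ 2)⁻¹, by positivity, 0, fun β hβ => ?_⟩
    obtain ⟨A, h1, h2⟩ := h β hβ
    rw [pow_zero, mul_one, inv_mul_le_iff₀ (by positivity)]
    nlinarith
  have hfill : ∀ (k : ℕ) (hk : k + 1 < N), k + 2 < N → ∀ z : Config N, EndsAligned z →
      Dominates w ρ z (Function.update z ⟨k + 1, hk⟩ true) := by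
    intro k
    induction k with
    | zero =>
      intro hk hk2 z hz
      by_cases hv : z ⟨0 + 1, hk⟩ = true
      · convert hrefl z using 1
        exact Function.update_eq_self_iff.2 hv.symm
      rw [Bool.not_eq_true] at hv
      have h01 : (0 : Fin N) ≠ ⟨0 + 1, hk⟩ := by simp [Fin.ext_iff]
      have h1l : lastIdx N ≠ ⟨0 + 1, hk⟩ := by simp [Fin.ext_iff, lastIdx]; omega
      have h0l := zero_ne_lastIdx hN
      set u := swapConf z 0 ⟨0 + 1, hk⟩ with hu
      have hu0 : u 0 = false := by simp [hu, swapConf, h01, hv]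
      have hul : u (lastIdx N) = false := by simp [hu, swapConf, h1l, h0l.symm, hz.2]
      have hne : u ≠ z := by
        intro h
        rw [h, hz.1] at hu0
        simp at hu0
      have hy : Function.update z ⟨0 + 1, hk⟩ true = flipConf u 0 := by
        ext i
        by_cases hi : i = 0
        · subst hi; simp [flipConf, hu0, h01, hz.1]
        · by_cases hi1 : i = ⟨0 + 1, hk⟩
          · subst hi1; simp [flipConf, hu, swapConf, h01.symm, hz.1]
          · simp only [zero_add] at hi1
            simp [flipConf, hu, swapConf, hi, hi1]
      rw [hy]
      refine twoStep z u _ fun β hβ => ⟨Real.exp (β * μL / 2), ?_, ?_⟩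
      · have := (hρ β hβ).mul_rate_le z (rate_le_exp_left hμL hμR hβ hu0 hul)
        rwa [rate_swapConf (by simp) hne, mul_one] at this
      · exact weight_le_of_left_empty hN hμL hμR (hρ β hβ) hβ hu0 hul
    | succ k ih =>
      intro hk hk2 z hz
      have hl : ∀ (m : ℕ) (hm : m < N), m + 1 < N → (⟨m, hm⟩ : Fin N) ≠ lastIdx N := by
        intro m hm h; simp [Fin.ext_iff, lastIdx]; omega
      exact setSite_of_exchange hrefl htrans
        (i := ⟨k + 1, by omega⟩) (j := ⟨k + 1 + 1, hk⟩) (by simp)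
        (fun z hz => hswap _ _ rfl (by simp [Fin.ext_iff]) (hl _ _ hk2) z hz)
        (EndsAligned.update (by simp [Fin.ext_iff]) (hl _ _ hk))
        (EndsAligned.update (by simp [Fin.ext_iff]) (hl _ _ hk2))
        (fun z hz => ih _ hk z hz) z hz
  have hempty : ∀ (k : ℕ) (i : Fin N), (i : ℕ) + k + 2 = N → i ≠ 0 → ∀ z : Config N,
      EndsAligned z → Dominates w ρ z (Function.update z i false) := by
    intro k
    induction k with
    | zero =>
      intro i hi hi0 z hz
      by_cases hv : z i = false
      · convert hrefl z using 1
        exact Function.update_eq_self_iff.2 hv.symm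
      rw [Bool.not_eq_false] at hv
      have hil : (lastIdx N : ℕ) = i + 1 := by simp [lastIdx]; omega
      have hne' : i ≠ lastIdx N := by intro h; rw [← h] at hil; omega
      have h0l := zero_ne_lastIdx hN
      set u := swapConf z i (lastIdx N) with hu
      have hu0 : u 0 = true := by simp [hu, swapConf, h0l, hi0.symm, hz.1]
      have hul : u (lastIdx N) = true := by simp [hu, swapConf, hv]
      have hne : u ≠ z := by
        intro h
        rw [h, hz.2] at hul
        simp at hul
      have hy : Function.update z i false = flipConf u (lastIdx N) := by
        ext j
        by_cases hj : j = lastIdx N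
        · subst hj; simp [flipConf, hul, hne'.symm, hz.2]
        · by_cases hji : j = i
          · subst hji; simp [flipConf, hu, swapConf, hne', hz.2]
          · simp [flipConf, hu, swapConf, hj, hji]
      rw [hy]
      refine twoStep z u _ fun β hβ => ⟨Real.exp (-(β * μR / 2)), ?_, ?_⟩
      · have := (hρ β hβ).mul_rate_le z (rate_le_exp_right hμL hμR hβ hu0 hul)
        rwa [rate_swapConf hil hne, mul_one] at this
      · exact weight_le_of_right_occupied hN hμL hμR (hρ β hβ) hβ hu0 hul
    | succ k ih =>
      intro j hj hj0 z hz
      have hi : (j : ℕ) + 1 < N := by omega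
      have hji : (⟨j + 1, hi⟩ : Fin N) ≠ j := by simp [Fin.ext_iff]
      have hi0 : (⟨j + 1, hi⟩ : Fin N) ≠ 0 := Fin.ne_of_val_ne (by simp)
      have hil : (⟨j + 1, hi⟩ : Fin N) ≠ lastIdx N := by simp [Fin.ext_iff, lastIdx]; omega
      have hjl : j ≠ lastIdx N := by simp [Fin.ext_iff, lastIdx]; omega
      exact setSite_of_exchange hrefl htrans (i := ⟨j + 1, hi⟩) (j := j) hji
        (fun z hz => by
          rw [swapConf_comm z hji]
          exact hswap _ _ rfl hj0 hil z hz)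
        (EndsAligned.update hi0 hil) (EndsAligned.update hj0 hjl)
        (fun z hz => ih _ (by simp; omega) hi0 z hz) z hz
  refine rel_of_setSite (G := EndsAligned) hrefl htrans
    (Finset.univ.filter fun i => i ≠ 0 ∧ i ≠ lastIdx N)
    (fun i hi => ?_) (fun i hi v z hz => ?_) hz (fun i hi => ?_)
  · simp at hi
    exact EndsAligned.update hi.1 hi.2
  · simp only [Finset.mem_filter, Finset.mem_univ, true_and] at hi
    have hi0 : (i : ℕ) ≠ 0 := fun h => hi.1 (Fin.ext (by simpa using h))
    have hil : (i : ℕ) ≠ N - 1 := fun h => hi.2 (Fin.ext h)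
    have hlt := i.2
    cases v
    · exact hempty (N - 2 - i) i (by omega) hi.1 z hz
    · have := hfill (i - 1) (by omega) (by omega) z hz
      convert this using 2
      exact Fin.ext (by simp; omega)
  · simp only [Finset.mem_filter, Finset.mem_univ, true_and, not_and_or, not_not] at hi
    rcases hi with rfl | rfl
    · rw [hz.1, hy.1]
    · rw [hz.2, hy.2]

open Filter in
/-- Configurations with aligned ends keep stationary weight bounded away from zero. -/
lemma exists_le_weight_of_endsAligned (hN : 2 ≤ N) (hμL : 0 < μL) (hμR : μR < 0)
    (hρ : ∀ β : ℝ, 0 < β → IsStationary 0 μL μR β (ρ β)) {x : Config N}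
    (hx : EndsAligned x) : ∃ c > 0, ∀ᶠ β in atTop, c ≤ ρ β x := by
  set K : ℝ := (Fintype.card (Config N) : ℝ) with hKdef
  have hδ : 0 < min μL (-μR) / 2 := by
    have := lt_min hμL (neg_pos.2 hμR)
    linarith
  have hdom : ∀ z : Config N, ∃ C ≥ 0, EndsAligned z → ∀ β > 0, ρ β z ≤ C * ρ β x := by
    intro z
    by_cases hz : EndsAligned z
    · obtain ⟨c, hc, n, h⟩ := dominates_one hN hμL hμR hρ hz hx
      refine ⟨c⁻¹, by positivity, fun _ β hβ => ?_⟩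
      have := h β hβ
      rw [one_pow, mul_one] at this
      rwa [inv_mul_eq_div, le_div_iff₀ hc, mul_comm]
    · exact ⟨0, le_rfl, fun h => absurd h hz⟩
  choose C hC0 hC using hdom
  have hsmall : ∀ᶠ β : ℝ in atTop,
      K * (K ^ 2 * Real.exp (-(β * (min μL (-μR) / 2)))) < 1 / 2 := by
    have h1 : Tendsto (fun β : ℝ => Real.exp (-(β * (min μL (-μR) / 2)))) atTop (nhds 0) :=
      Real.tendsto_exp_neg_atTop_nhds_zero.comp (tendsto_id.atTop_mul_const hδ)
    have h2 := (h1.const_mul (K ^ 2)).const_mul K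
    rw [mul_zero, mul_zero] at h2
    exact h2.eventually_lt_const (by norm_num)
  have hS : 0 < 2 * (∑ z, C z + 1) := by
    have := Finset.sum_nonneg fun z (_ : z ∈ Finset.univ) => hC0 z
    linarith
  refine ⟨(2 * (∑ z, C z + 1))⁻¹, by positivity, ?_⟩
  filter_upwards [hsmall, eventually_gt_atTop 0] with β hβs hβ
  set e := K ^ 2 * Real.exp (-(β * (min μL (-μR) / 2))) with he
  have he0 : 0 ≤ e := by positivity
  have hst := hρ β hβ
  have hsum : (1 : ℝ) ≤ ∑ z, (C z * ρ β x + e) := by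
    rw [← hst.2.1]
    refine Finset.sum_le_sum fun z _ => ?_
    by_cases hz : EndsAligned z
    · linarith [hC z hz β hβ]
    · have h1 := weight_le_exp_of_not_endsAligned hN hμL hμR hst hβ hz
      have h2 := mul_nonneg (hC0 z) (hst.1 x)
      linarith
  rw [Finset.sum_add_distrib, ← Finset.sum_mul, Finset.sum_const, nsmul_eq_mul,
    Finset.card_univ, ← hKdef] at hsum
  rw [inv_le_iff_one_le_mul₀ hS]
  nlinarith [hst.1 x]

open Filter in
/-- Every stationary weight is at least exponentially small. -/
lemma exists_exp_le_weight (hN : 2 ≤ N) (hμL : 0 < μL) (hμR : μR < 0)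
    (hρ : ∀ β : ℝ, 0 < β → IsStationary 0 μL μR β (ρ β)) (x : Config N) :
    ∃ c > 0, ∃ D : ℝ, ∀ᶠ β in atTop, c * Real.exp (-(D * β)) ≤ ρ β x := by
  set z : Config N := Function.update (fun _ => false) 0 true with hz
  have hzG : EndsAligned z := by simp [hz, EndsAligned, (zero_ne_lastIdx hN).symm]
  obtain ⟨c, hc, h⟩ := exists_le_weight_of_endsAligned hN hμL hμR hρ hzG
  obtain ⟨d, hd, n, h'⟩ := dominates_exp hμL hμR hρ z x
  refine ⟨d * c, by positivity, n * ((μL - μR) / 2), ?_⟩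
  filter_upwards [h, eventually_gt_atTop 0] with β h1 hβ
  refine le_trans ?_ (h' β hβ)
  rw [← Real.exp_nat_mul]
  calc d * c * Real.exp (-(n * ((μL - μR) / 2) * β))
      = d * Real.exp (n * -(β * ((μL - μR) / 2))) * c := by ring_nf
    _ ≤ _ := mul_le_mul_of_nonneg_left h1 (by positivity)

end Bounds

end Kawasaki

open Kawasaki Filter in
/-- boundary driven simple exclusion process (`κ = 0`) with
`μ_L > 0 > μ_R`: the stationary distribution satisfies `(1/β) log ρ_β(x) → 0` iff
`x(1) = 1` and `x(N) = 0`; for every other configuration the limsup of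
`(1/β) log ρ_β(x)` is negative. -/
theorem statement15 (N : ℕ) [NeZero N] (hN : 2 ≤ N) (μL μR : ℝ)
    (hμL : 0 < μL) (hμR : μR < 0)
    (ρ : ℝ → Config N → ℝ)
    (hρ : ∀ β : ℝ, 0 < β → IsStationary 0 μL μR β (ρ β)) :
    ∀ x : Config N,
      (Tendsto (fun β : ℝ => Real.log (ρ β x) / β) atTop (nhds 0) ↔
        (x 0 = true ∧ x (lastIdx N) = false)) ∧
      (¬ (x 0 = true ∧ x (lastIdx N) = false) →
        Filter.limsup (fun β : ℝ => Real.log (ρ β x) / β) atTop < 0) := by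
  intro x
  have hδ : 0 < min μL (-μR) / 2 := by
    have := lt_min hμL (neg_pos.2 hμR)
    linarith
  set δ := min μL (-μR) / 2 with hδdef
  have hconst : ∀ a : ℝ, Tendsto (fun β : ℝ => a / β) atTop (nhds 0) := fun a =>
    tendsto_const_nhds.div_atTop tendsto_id
  have hneg : ¬ EndsAligned x → ∀ᶠ β in atTop, Real.log (ρ β x) / β ≤ -(δ / 2) := by
    intro hx
    obtain ⟨c, hc, D, hlow⟩ := exists_exp_le_weight hN hμL hμR hρ x
    have hK : (0 : ℝ) < Fintype.card (Config N) := card_config_pos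
    filter_upwards [hlow, eventually_gt_atTop 0,
      (hconst (Real.log ((Fintype.card (Config N) : ℝ) ^ 2))).eventually_lt_const
        (half_pos hδ)] with β h1 hβ h2
    have hpos : 0 < ρ β x := lt_of_lt_of_le (by positivity) h1
    have h3 := Real.log_le_log hpos
      (weight_le_exp_of_not_endsAligned hN hμL hμR (hρ β hβ) hβ hx)
    rw [Real.log_mul (by positivity) (Real.exp_pos _).ne', Real.log_exp, ← hδdef] at h3
    rw [div_lt_iff₀ hβ] at h2
    rw [div_le_iff₀ hβ]
    linarith
  refine ⟨⟨fun h => ?_, fun hx => ?_⟩, fun hx => ?_⟩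
  · by_contra hx
    have := le_of_tendsto h (hneg hx)
    linarith
  · obtain ⟨c, hc, hlow⟩ := exists_le_weight_of_endsAligned hN hμL hμR hρ hx
    refine tendsto_of_tendsto_of_tendsto_of_le_of_le' (hconst (Real.log c))
      tendsto_const_nhds ?_ ?_
    · filter_upwards [hlow, eventually_gt_atTop 0] with β h1 hβ
      exact div_le_div_of_nonneg_right (Real.log_le_log hc h1) hβ.le
    · filter_upwards [eventually_gt_atTop 0] with β hβ
      exact div_nonpos_of_nonpos_of_nonneg
        (Real.log_nonpos ((hρ β hβ).1 x) ((hρ β hβ).le_one x)) hβ.le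
  · obtain ⟨c, hc, D, hlow⟩ := exists_exp_le_weight hN hμL hμR hρ x
    have hbdd : IsBoundedUnder (· ≥ ·) atTop fun β : ℝ => Real.log (ρ β x) / β := by
      refine ⟨-1 - D, ?_⟩
      rw [eventually_map]
      filter_upwards [hlow, eventually_gt_atTop 0,
        (hconst (Real.log c)).eventually_const_lt (show (-1 : ℝ) < 0 by norm_num)]
        with β h1 hβ h2
      have h3 := Real.log_le_log (by positivity) h1
      rw [Real.log_mul hc.ne' (Real.exp_pos _).ne', Real.log_exp] at h3
      rw [lt_div_iff₀ hβ] at h2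
      rw [ge_iff_le, le_div_iff₀ hβ]
      linarith
    have := limsup_le_of_le hbdd.isCoboundedUnder_le (hneg hx)
    linarith
end

section
/- Consider an irreducible jump process on a finite state space K with rates of the form k(x,y;β) = exp[βE(x) − βΔ(x,y)] for allowed transitions, where Δ is symmetric: Δ(x,y) = Δ(y,x). Then Γ(x) = −E(x) + v(x) and U(y,z) = Δ(y,z) − v(y) where v(z) = min_u Δ(z,u); moreover there is a constant C (independent of x) such that Θ(x) = v(x) + C for all x, and hence Ψ(x) = −E(x) − C for all x, so the maximizers of Ψ are exactly the minimizers of the energy E. -/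
open scoped Classical

namespace Kirchhoff

variable {K : Type*}

/-- `Γ(x) = -max_y φ(x,y)`, the maximum being over the allowed transitions from `x`. -/
noncomputable def Gam [Fintype K] (A : K → K → Prop) (φ : K → K → ℝ) (x : K) : ℝ :=
  - sSup (φ x '' {y | A x y})

/-- `U(x,y) = -φ(x,y) - Γ(x)` (meaningful on allowed transitions). -/
noncomputable def Ucost [Fintype K] (A : K → K → Prop) (φ : K → K → ℝ) (x y : K) : ℝ :=
  - φ x y - Gam A φ x

/-- `t` encodes a spanning tree of the transition graph with all edges oriented toward
the root `x`: `t y` is the successor of `y` on the unique path from `y` to `x`. -/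
def IsInTree (A : K → K → Prop) (t : K → K) (x : K) : Prop :=
  t x = x ∧ (∀ y, y ≠ x → A y (t y)) ∧ ∀ y, ∃ n : ℕ, t^[n] y = x

/-- `U(𝒯_x)`: the sum of `U` over the oriented edges of the in-tree. -/
noncomputable def treeCost [Fintype K] (A : K → K → Prop) (φ : K → K → ℝ)
    (t : K → K) (x : K) : ℝ :=
  ∑ y : K, if y = x then 0 else Ucost A φ y (t y)

/-- `Θ(x) = min_𝒯 U(𝒯_x)`. -/
noncomputable def Theta [Fintype K] (A : K → K → Prop) (φ : K → K → ℝ) (x : K) : ℝ :=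
  sInf { c | ∃ t : K → K, IsInTree A t x ∧ c = treeCost A φ t x }

/-- `Ψ = Γ - Θ`. -/
noncomputable def Psi [Fintype K] (A : K → K → Prop) (φ : K → K → ℝ) (x : K) : ℝ :=
  Gam A φ x - Theta A φ x

/-- `v(z) = min_u Δ(z,u)`, the minimum being over the allowed transitions from `z`. -/
noncomputable def vmin [Fintype K] (A : K → K → Prop) (Δ : K → K → ℝ) (z : K) : ℝ :=
  sInf (Δ z '' {u | A z u})

end Kirchhoff

namespace Kirchhoff

/-- The sum of the edge weights `Δ` over the in-tree `t` rooted at `x`. -/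
noncomputable def treeWeight {K : Type*} [Fintype K] (Δ : K → K → ℝ) (t : K → K) (x : K) : ℝ :=
  ∑ y : K, if y = x then 0 else Δ y (t y)

/-- Reversing the edge `u → x` of an in-tree rooted at `x` makes `u` the root. -/
noncomputable def reroot {K : Type*} (t : K → K) (x u : K) : K → K :=
  Function.update (Function.update t x u) u u

section reroot

variable {K : Type*} {A : K → K → Prop} {t : K → K} {x u : K}

lemma reroot_root : reroot t x u u = u := by simp [reroot]

lemma reroot_old_root (hu : u ≠ x) : reroot t x u x = u := by
  simp [reroot, Function.update_of_ne hu.symm]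

lemma reroot_of_ne {z : K} (hx : z ≠ x) (hu : z ≠ u) : reroot t x u z = t z := by
  simp [reroot, hx, hu]

lemma IsInTree.reroot (hsymm : ∀ y z : K, A y z ↔ A z y) (ht : IsInTree A t x)
    (hu : u ≠ x) (htu : t u = x) : IsInTree A (reroot t x u) u := by
  obtain ⟨-, hA, hreach⟩ := ht
  refine ⟨reroot_root, fun y hy => ?_, fun y => ?_⟩
  · by_cases hyx : y = x
    · subst hyx
      rw [reroot_old_root hu, ← hsymm]
      simpa [htu] using hA u hu
    · rw [reroot_of_ne hyx hy]
      exact hA y hyx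
  · obtain ⟨n, hn⟩ := hreach y
    induction n generalizing y with
    | zero =>
      obtain rfl : y = x := hn
      exact ⟨1, reroot_old_root hu⟩
    | succ n ih =>
      by_cases hyu : y = u
      · exact ⟨0, hyu⟩
      by_cases hyx : y = x
      · subst hyx
        exact ⟨1, reroot_old_root hu⟩
      obtain ⟨m, hm⟩ := ih (t y) (by rwa [Function.iterate_succ_apply] at hn)
      exact ⟨m + 1, by rwa [Function.iterate_succ_apply, reroot_of_ne hyx hyu]⟩

lemma exists_iterate_reroot (hx : t x = x) (hu : u ≠ x) {n : ℕ} {z : K} (hz : t^[n] z = u) :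
    ∃ m ≤ n, (reroot t x u)^[m] z = u := by
  induction n generalizing z with
  | zero => exact ⟨0, le_rfl, hz⟩
  | succ n ih =>
    by_cases hzu : z = u
    · exact ⟨0, Nat.zero_le _, hzu⟩
    by_cases hzx : z = x
    · subst hzx
      exact absurd (hz.symm.trans (Function.iterate_fixed hx _)) hu
    obtain ⟨m, hmn, hm⟩ := ih (z := t z) (by rwa [Function.iterate_succ_apply] at hz)
    exact ⟨m + 1, by omega, by rwa [Function.iterate_succ_apply, reroot_of_ne hzx hzu]⟩

lemma treeWeight_reroot [Fintype K] {Δ : K → K → ℝ} (hu : u ≠ x) (htu : t u = x)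
    (hΔ : Δ u x = Δ x u) : treeWeight Δ (reroot t x u) u = treeWeight Δ t x := by
  refine Fintype.sum_equiv (Equiv.swap x u) _ _ fun y => ?_
  by_cases hyx : y = x
  · subst hyx
    simp [hu, hu.symm, reroot_old_root hu, htu, hΔ]
  by_cases hyu : y = u
  · simp [hyu]
  · simp [Equiv.swap_apply_of_ne_of_ne hyx hyu, hyx, hyu, reroot_of_ne hyx hyu]

end reroot

lemma exists_isInTree {K : Type*} {A : K → K → Prop}
    (hconn : ∀ x y : K, Relation.ReflTransGen A x y) (x : K) : ∃ t, IsInTree A t x := by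
  let P : ℕ → K → Prop := Nat.rec (motive := fun _ => K → Prop) (· = x) (fun _ Q y => ∃ z, A y z ∧ Q z)
  have hP : ∀ y, ∃ n, P n y := fun y => by
    induction hconn y x using Relation.ReflTransGen.head_induction_on with
    | refl => exact ⟨0, rfl⟩
    | head h _ ih =>
      obtain ⟨n, hn⟩ := ih
      exact ⟨n + 1, _, h, hn⟩
  let d : K → ℕ := fun y => Nat.find (hP y)
  have hstep : ∀ y, ∃ z, y ≠ x → A y z ∧ d z < d y := fun y => by
    by_cases hy : y = x
    · exact ⟨x, fun h => absurd hy h⟩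
    have hd : P (d y) y := Nat.find_spec (hP y)
    obtain hd0 | ⟨n, hn⟩ : d y = 0 ∨ ∃ n, d y = n + 1 := by
      cases d y <;> simp
    · rw [hd0] at hd
      exact absurd hd hy
    · rw [hn] at hd
      obtain ⟨z, hz, hPz⟩ := hd
      have : d z ≤ n := Nat.find_min' (hP z) hPz
      exact ⟨z, fun _ => ⟨hz, by omega⟩⟩
  choose s hs using hstep
  refine ⟨Function.update s x x, by simp, fun y hy => by simpa [hy] using (hs y hy).1, fun y => ?_⟩
  induction hn : d y using Nat.strong_induction_on generalizing y with
  | _ n ih =>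
    by_cases hy : y = x
    · exact ⟨0, hy⟩
    obtain ⟨m, hm⟩ := ih _ (hn ▸ (hs y hy).2) (s y) rfl
    exact ⟨m + 1, by rwa [Function.iterate_succ_apply, Function.update_of_ne hy]⟩

section

variable {K : Type*} [Fintype K] {A : K → K → Prop} {Δ : K → K → ℝ}

/-- An in-tree can be re-rooted at any vertex without changing a symmetric weight. -/
lemma exists_inTree_treeWeight_eq (hsymm : ∀ x y : K, A x y ↔ A y x)
    (hΔsymm : ∀ x y : K, A x y → Δ x y = Δ y x) {t : K → K} {x : K} (ht : IsInTree A t x)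
    (w : K) : ∃ t', IsInTree A t' w ∧ treeWeight Δ t' w = treeWeight Δ t x := by
  obtain ⟨n, hn⟩ := ht.2.2 w
  induction n using Nat.strong_induction_on generalizing t x with
  | _ n ih =>
    cases n with
    | zero =>
      obtain rfl : w = x := hn
      exact ⟨t, ht, rfl⟩
    | succ n =>
      by_cases hu : t^[n] w = x
      · exact ih n n.lt_succ_self ht hu
      have htu : t (t^[n] w) = x := by rwa [Function.iterate_succ_apply'] at hn
      obtain ⟨m, hmn, hm⟩ := exists_iterate_reroot ht.1 hu (rfl : t^[n] w = _)
      obtain ⟨t', ht', hw⟩ := ih m (by omega) (ht.reroot hsymm hu htu) hm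
      refine ⟨t', ht', hw.trans (treeWeight_reroot hu htu (hΔsymm _ _ ?_))⟩
      simpa [htu] using ht.2.1 _ hu

lemma isLeast_vmin {x : K} (hout : ∃ y, A x y) : IsLeast (Δ x '' {u | A x u}) (vmin A Δ x) :=
  have hfin := (Set.toFinite {u | A x u}).image (Δ x)
  ⟨Set.Nonempty.csInf_mem (Set.Nonempty.image _ hout) hfin,
    fun _ h => csInf_le hfin.bddBelow h⟩

lemma Gam_sub_eq (E : K → ℝ) {x : K} (hout : ∃ y, A x y) :
    Gam A (fun x y => E x - Δ x y) x = -E x + vmin A Δ x := by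
  obtain ⟨⟨u, hu, hu'⟩, hle⟩ := isLeast_vmin (Δ := Δ) hout
  have h : IsGreatest ((fun y => E x - Δ x y) '' {y | A x y}) (E x - vmin A Δ x) := by
    refine ⟨⟨u, hu, by simp [hu']⟩, ?_⟩
    rintro _ ⟨y, hy, rfl⟩
    exact sub_le_sub_left (hle ⟨y, hy, rfl⟩) _
  rw [Gam, h.csSup_eq]
  ring

lemma Ucost_sub_eq (E : K → ℝ) {y : K} (hout : ∃ z, A y z) (z : K) :
    Ucost A (fun x y => E x - Δ x y) y z = Δ y z - vmin A Δ y := by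
  rw [Ucost, Gam_sub_eq E hout]
  ring

lemma treeCost_sub_eq (E : K → ℝ) (hout : ∀ x : K, ∃ y : K, A x y) (t : K → K) (x : K) :
    treeCost A (fun x y => E x - Δ x y) t x =
      treeWeight Δ t x + (vmin A Δ x - ∑ y, vmin A Δ y) := by
  have hv : vmin A Δ x = ∑ y, if y = x then vmin A Δ y else 0 := by simp
  rw [hv, ← Finset.sum_sub_distrib, treeWeight, ← Finset.sum_add_distrib, treeCost]
  refine Finset.sum_congr rfl fun y _ => ?_
  split_ifs
  · simp
  · rw [Ucost_sub_eq E (hout y)]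
    ring

/-- `Θ - v` is constant: its value is the minimal tree weight minus `∑ y, v y`. -/
lemma exists_Theta_sub_eq [Nonempty K] (E : K → ℝ) (hsymm : ∀ x y : K, A x y ↔ A y x)
    (hconn : ∀ x y : K, Relation.ReflTransGen A x y) (hout : ∀ x : K, ∃ y : K, A x y)
    (hΔsymm : ∀ x y : K, A x y → Δ x y = Δ y x) :
    ∃ C : ℝ, ∀ x : K, Theta A (fun x y => E x - Δ x y) x = vmin A Δ x + C := by
  obtain ⟨r⟩ := ‹Nonempty K›
  obtain ⟨t, ht, hmin⟩ := Set.exists_min_image {t | IsInTree A t r} (treeWeight Δ · r)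
    (Set.toFinite _) (exists_isInTree hconn r)
  refine ⟨treeWeight Δ t r - ∑ y, vmin A Δ y, fun x => IsLeast.csInf_eq ⟨?_, ?_⟩⟩
  · obtain ⟨t', ht', hw⟩ := exists_inTree_treeWeight_eq hsymm hΔsymm ht x
    refine ⟨t', ht', ?_⟩
    rw [treeCost_sub_eq E hout, hw]
    ring
  · rintro _ ⟨t', ht', rfl⟩
    obtain ⟨t'', ht'', hw⟩ := exists_inTree_treeWeight_eq hsymm hΔsymm ht' r
    have := hmin t'' ht''
    rw [treeCost_sub_eq E hout]
    linarith

end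

end Kirchhoff

open Kirchhoff in
/-- for rates of detailed-balance form `k(x,y;β) = exp[βE(x) - βΔ(x,y)]`
with symmetric `Δ` on a connected transition graph (so `φ(x,y) = E(x) - Δ(x,y)`):
`Γ(x) = -E(x) + v(x)`, `U(y,z) = Δ(y,z) - v(y)` on allowed transitions, `Θ = v + C` for
a constant `C`, hence `Ψ = -E - C` and the maximizers of `Ψ` are exactly the minimizers
of the energy `E`. -/
theorem statement16 {K : Type*} [Fintype K] [Nonempty K]
    (A : K → K → Prop) (k : ℝ → K → K → ℝ) (E : K → ℝ) (Δ : K → K → ℝ)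
    (hsymm : ∀ x y : K, A x y ↔ A y x)
    (hconn : ∀ x y : K, Relation.ReflTransGen A x y)
    (hout : ∀ x : K, ∃ y : K, A x y)
    (hk : ∀ (β : ℝ) (x y : K), A x y → k β x y = Real.exp (β * E x - β * Δ x y))
    (hkzero : ∀ (β : ℝ) (x y : K), ¬ A x y → k β x y = 0)
    (hΔsymm : ∀ x y : K, A x y → Δ x y = Δ y x) :
    (∀ x : K, Gam A (fun x y => E x - Δ x y) x = -E x + vmin A Δ x) ∧
    (∀ y z : K, A y z → Ucost A (fun x y => E x - Δ x y) y z = Δ y z - vmin A Δ y) ∧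
    (∃ C : ℝ,
      (∀ x : K, Theta A (fun x y => E x - Δ x y) x = vmin A Δ x + C) ∧
      (∀ x : K, Psi A (fun x y => E x - Δ x y) x = -E x - C) ∧
      (∀ x : K, (∀ y : K, Psi A (fun x y => E x - Δ x y) y ≤
          Psi A (fun x y => E x - Δ x y) x) ↔ (∀ y : K, E x ≤ E y))) := by
  obtain ⟨C, hC⟩ := exists_Theta_sub_eq E hsymm hconn hout hΔsymm
  have hPsi : ∀ x : K, Psi A (fun x y => E x - Δ x y) x = -E x - C := fun x => by
    rw [Psi, Gam_sub_eq E (hout x), hC]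
    ring
  refine ⟨fun x => Gam_sub_eq E (hout x), fun y z hyz => Ucost_sub_eq E ⟨z, hyz⟩ z,
    C, hC, hPsi, fun x => ?_⟩
  simp [hPsi]
end
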